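/- Let κ be a positive integer and n ∈ ℤ. For every λ ∈ ℂ and every τ in the upper half-plane, θ_{κ,n}(λ/τ, −1/τ) = √(−iτ/(2κ)) · e^{πiκλ²/(2τ)} · Σ_{m=0}^{2κ−1} e^{−πimn/κ} θ_{κ,m}(λ,τ), where √ denotes the principal branch of the square root (note Re(−iτ) > 0, so |arg(−iτ)| < π/2). -/

import Mathlib

open Complex

/-- The complex number π. -/
noncomputable def cπ : ℂ := Real.pi

/-- The first Jacobi theta function
`ϑ₁(λ,τ) = 2 q^{1/8} sin(πλ) ∏_{j≥1} (1-q^j e^{2πiλ})(1-q^j e^{-2πiλ})(1-q^j)`, `q = e^{2πiτ}`. -/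
noncomputable def JTheta1 (z τ : ℂ) : ℂ :=
  2 * exp (cπ * I * τ / 4) * sin (cπ * z) *
    ∏' n : ℕ, ((1 - exp (2 * cπ * I * τ) ^ (n + 1) * exp (2 * cπ * I * z)) *
      (1 - exp (2 * cπ * I * τ) ^ (n + 1) * exp (-(2 * cπ * I * z))) *
      (1 - exp (2 * cπ * I * τ) ^ (n + 1)))

/-- The Dedekind eta function `η(τ) = q^{1/24} ∏_{j≥1} (1-q^j)`, `q = e^{2πiτ}`. -/
noncomputable def DEta (τ : ℂ) : ℂ :=
  exp (cπ * I * τ / 12) * ∏' n : ℕ, (1 - exp (2 * cπ * I * τ) ^ (n + 1))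

/-- The theta function of level κ:
`θ_{κ,n}(λ,τ) = Σ_{j∈ℤ} exp(2πiκ(j+n/(2κ))²τ + 2πiκ(j+n/(2κ))λ)`. -/
noncomputable def ThetaKN (κ : ℕ) (n : ℤ) (z τ : ℂ) : ℂ :=
  ∑' j : ℤ, exp (2 * cπ * I * (κ : ℂ) * ((j : ℂ) + (n : ℂ) / (2 * (κ : ℂ))) ^ 2 * τ +
    2 * cπ * I * (κ : ℂ) * ((j : ℂ) + (n : ℂ) / (2 * (κ : ℂ))) * z)

/-- The symmetrization `θ^s_{κ,n}(λ,τ) = θ_{κ,n}(λ,τ) + θ_{κ,n}(-λ,τ)`. -/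
noncomputable def ThetaS (κ : ℕ) (n : ℤ) (z τ : ℂ) : ℂ :=
  ThetaKN κ n z τ + ThetaKN κ n (-z) τ

/-- `ρ(λ,τ) = ϑ₁'(λ,τ)/ϑ₁(λ,τ)` (derivative in the first argument). -/
noncomputable def Rho (z τ : ℂ) : ℂ :=
  deriv (fun w => JTheta1 w τ) z / JTheta1 z τ

/-- `ρ'(λ,τ)`, the derivative of `ρ` in the first argument. -/
noncomputable def Rho' (z τ : ℂ) : ℂ := deriv (fun w => Rho w τ) z

/-- `u` satisfies the KZB heat equation with parameters `κ`, `p` at `(λ,τ)`: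
`2πiκ ∂u/∂τ = ∂²u/∂λ² + p(p+1)ρ'(λ,τ)u`. -/
def KZB (κ p : ℕ) (u : ℂ → ℂ → ℂ) (z τ : ℂ) : Prop :=
  2 * cπ * I * (κ : ℂ) * deriv (fun t => u z t) τ =
    iteratedDeriv 2 (fun w => u w τ) z + (p : ℂ) * ((p : ℂ) + 1) * Rho' z τ * u z τ

lemma aux_sum (κ : ℕ) (hκ : 0 < κ) (n : ℤ) (z τ : ℂ) (hτ : 0 < τ.im) :
    ∑ m ∈ Finset.range (2 * κ),
          exp (-(cπ * I * (m : ℂ) * (n : ℂ) / (κ : ℂ))) * ThetaKN κ (m : ℤ) z τ =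
      jacobiTheta₂ (z / 2 - n / (2 * κ)) (τ / (2 * κ)) := by
  have hκ' : (κ : ℂ) ≠ 0 := by exact_mod_cast hκ.ne'
  have : NeZero (2 * κ) := ⟨by omega⟩
  have hT : 0 < (τ / (2 * κ)).im := by
    have h : τ / (2 * κ) = τ / ((2 * κ : ℝ) : ℂ) := by push_cast; rfl
    rw [h, div_ofReal_im]
    positivity
  have hs := (summable_jacobiTheta₂_term_iff (z / 2 - n / (2 * κ)) (τ / (2 * κ))).mpr hT
  have hs2 := (Int.divModEquiv (2 * κ)).symm.summable_iff.mpr hs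
  have hs3 := (Equiv.prodComm (Fin (2 * κ)) ℤ).summable_iff.mpr hs2
  simp only [Function.comp_def] at hs3
  rw [jacobiTheta₂, ← (Int.divModEquiv (2 * κ)).symm.tsum_eq,
    ← (Equiv.prodComm (Fin (2 * κ)) ℤ).tsum_eq, Summable.tsum_prod hs3, tsum_fintype,
    Finset.sum_range]
  refine Finset.sum_congr rfl fun m _ => ?_
  rw [ThetaKN, ← tsum_mul_left]
  refine tsum_congr fun j => ?_
  rw [← Complex.exp_add]
  simp only [Equiv.prodComm_apply, Prod.swap_prod_mk, Int.divModEquiv_symm_apply,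
    jacobiTheta₂_term, cπ]
  rw [Complex.exp_eq_exp_iff_exists_int]
  refine ⟨j * n, ?_⟩
  push_cast
  field_simp
  ring

/-- Modular property in `τ ↦ -1/τ`: for all `λ ∈ ℂ` and `τ ∈ ℍ`,
`θ_{κ,n}(λ/τ, -1/τ) = √(-iτ/(2κ)) e^{πiκλ²/(2τ)} Σ_{m=0}^{2κ-1} e^{-πimn/κ} θ_{κ,m}(λ,τ)`,
where the square root is the principal branch (here realized as the principal complex
power `w ^ (1/2)`; note `Re(-iτ) > 0` for `τ ∈ ℍ`). -/
theorem thetaKN_S (κ : ℕ) (hκ : 0 < κ) (n : ℤ) (z τ : ℂ) (hτ : 0 < τ.im) :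
    ThetaKN κ n (z / τ) (-1 / τ) =
      (-I * τ / (2 * (κ : ℂ))) ^ (1 / 2 : ℂ) * exp (cπ * I * (κ : ℂ) * z ^ 2 / (2 * τ)) *
        ∑ m ∈ Finset.range (2 * κ),
          exp (-(cπ * I * (m : ℂ) * (n : ℂ) / (κ : ℂ))) * ThetaKN κ (m : ℤ) z τ := by
  have hκ' : (κ : ℂ) ≠ 0 := by exact_mod_cast hκ.ne'
  have hτ0 : τ ≠ 0 := by rintro rfl; simp at hτ
  rw [aux_sum κ hκ n z τ hτ, jacobiTheta₂_functional_equation]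
  have e : -I * (τ / (2 * (κ : ℂ))) = -I * τ / (2 * (κ : ℂ)) := by ring
  have hne : (-I * τ / (2 * (κ : ℂ))) ^ (1 / 2 : ℂ) ≠ 0 := by
    rw [Complex.cpow_ne_zero_iff]
    left
    simp [hτ0, hκ']
  rw [e]
  have key : ThetaKN κ n (z / τ) (-1 / τ) = exp (cπ * I * (κ : ℂ) * z ^ 2 / (2 * τ)) *
      (exp (-Real.pi * I * (z / 2 - n / (2 * κ)) ^ 2 / (τ / (2 * κ))) *
        jacobiTheta₂ ((z / 2 - n / (2 * κ)) / (τ / (2 * κ))) (-1 / (τ / (2 * κ)))) := by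
    rw [ThetaKN, jacobiTheta₂, ← tsum_mul_left, ← tsum_mul_left]
    refine tsum_congr fun j => ?_
    rw [jacobiTheta₂_term, ← Complex.exp_add, ← Complex.exp_add]
    congr 1
    simp only [cπ]
    field_simp
    ring
  rw [key]
  field_simp
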